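/- (Recurrent quadratics are non-diophantine — Lemma A.13.) Let I ⊆ ℤ be a discrete interval, let α, β, γ ∈ ℝ, and let 0 < δ₁, δ₂ < 1 with δ₁ ≤ δ₂/4. Suppose the set {l ∈ I : ‖αl² + βl + γ‖_{ℝ/ℤ} ≤ δ₁} has cardinality at least δ₂|I|, and that |I| ≥ 2⁵⁸ δ₂⁻¹². Then there exists an integer q with 1 ≤ q ≤ 2⁴³ δ₂⁻⁹ such that ‖qα‖_{ℝ/ℤ} ≤ 2¹⁴¹ δ₂⁻²⁸ |I|⁻². -/

import Mathlib

open Finset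

/-- `‖x‖_{ℝ/ℤ}` is the distance from `x` to the nearest integer. -/
noncomputable def distToInt (x : ℝ) : ℝ := |x - round x|

/-! ### The distance to the nearest integer -/

lemma distToInt_nonneg (x : ℝ) : 0 ≤ distToInt x := abs_nonneg _

lemma distToInt_le_abs_sub (x : ℝ) (n : ℤ) : distToInt x ≤ |x - n| := round_le x n

lemma distToInt_sub_le (x y : ℝ) : distToInt (x - y) ≤ distToInt x + distToInt y := by
  refine (distToInt_le_abs_sub _ (round x - round y)).trans ?_
  have h := abs_sub (x - round x) (y - round y)
  rw [show x - y - ((round x - round y : ℤ) : ℝ) = x - round x - (y - round y) by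
    push_cast; ring]
  exact h

lemma distToInt_sub_intCast (x : ℝ) (n : ℤ) : distToInt (x - n) = distToInt x := by
  simp [distToInt, round_sub_intCast]

lemma distToInt_eq_abs {x : ℝ} (hx : |x| ≤ 1 / 2) : distToInt x = |x| := by
  refine le_antisymm (by simpa using distToInt_le_abs_sub x 0) ?_
  by_cases h : round x = 0
  · simp [distToInt, h]
  · have h1 : (1 : ℝ) ≤ |(round x : ℝ)| := by exact_mod_cast Int.one_le_abs h
    have h2 := abs_sub_abs_le_abs_sub (round x : ℝ) x
    rw [abs_sub_comm] at h2
    unfold distToInt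
    linarith

/-! ### Fourier expansion of a trapezoid -/

lemma hasSum_cos_div_sq {x : ℝ} (hx : |x| ≤ 1) :
    HasSum (fun n : ℕ => 1 / (n : ℝ) ^ 2 * Real.cos (2 * Real.pi * n * x))
      (Real.pi ^ 2 * (x ^ 2 - |x| + 1 / 6)) := by
  have h := hasSum_one_div_nat_pow_mul_cos one_ne_zero (x := |x|) ⟨abs_nonneg x, hx⟩
  convert! h using 1
  · ext n
    rw [mul_one, ← Real.cos_abs (2 * Real.pi * n * x), abs_mul,
      abs_of_nonneg (by positivity : 0 ≤ 2 * Real.pi * n)]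
  · simp [Polynomial.bernoulli, Finset.sum_range_succ, bernoulli_two, bernoulli_one,
      Nat.factorial]
    ring_nf

/-- Fourier coefficients, up to a constant factor, of the trapezoid which is maximal on
`‖x‖ ≤ δ / 4` and vanishes for `‖x‖ ≥ δ / 2`. -/
noncomputable def trapezoidCoeff (δ : ℝ) (n : ℕ) : ℝ :=
  1 / (n : ℝ) ^ 2 * (2 * Real.cos (Real.pi * n * δ) - 2 * Real.cos (Real.pi * n * δ / 2))

lemma abs_trapezoidCoeff_le (δ : ℝ) (n : ℕ) : |trapezoidCoeff δ n| ≤ 4 * (1 / (n : ℝ) ^ 2) := by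
  rw [trapezoidCoeff, abs_mul, abs_of_nonneg (by positivity : 0 ≤ 1 / (n : ℝ) ^ 2), mul_comm]
  gcongr
  rw [abs_le]
  constructor <;>
  linarith [Real.cos_le_one (Real.pi * n * δ), Real.cos_le_one (Real.pi * n * δ / 2),
    Real.neg_one_le_cos (Real.pi * n * δ), Real.neg_one_le_cos (Real.pi * n * δ / 2)]

lemma hasSum_trapezoid {δ : ℝ} (hδ0 : 0 < δ) (hδ1 : δ < 1) (y : ℝ) :
    ∃ V : ℝ, 0 ≤ V ∧ (distToInt y ≤ δ / 4 → δ / 2 ≤ V) ∧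
      HasSum (fun n : ℕ => trapezoidCoeff δ n * Real.cos (2 * Real.pi * n * y))
        (Real.pi ^ 2 * (3 * δ ^ 2 / 8 - V)) := by
  set x := y - round y with hx
  have hx2 : |x| ≤ 1 / 2 := abs_sub_round y
  have hx3 := abs_le.1 hx2
  refine ⟨|x + δ / 2| + |x - δ / 2| - |x + δ / 4| - |x - δ / 4|, ?_, ?_, ?_⟩
  · rcases abs_cases (x + δ / 2) with h1 | h1 <;> rcases abs_cases (x - δ / 2) with h2 | h2 <;>
    rcases abs_cases (x + δ / 4) with h3 | h3 <;> rcases abs_cases (x - δ / 4) with h4 | h4 <;>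
    linarith
  · intro h
    have h := abs_le.1 (show |x| ≤ δ / 4 from h)
    rw [abs_of_nonneg (by linarith : 0 ≤ x + δ / 2), abs_of_nonpos (by linarith : x - δ / 2 ≤ 0),
      abs_of_nonneg (by linarith : 0 ≤ x + δ / 4), abs_of_nonpos (by linarith : x - δ / 4 ≤ 0)]
    linarith
  · have key (c : ℝ) (hc : |c| ≤ 1 / 2) := hasSum_cos_div_sq (x := x + c)
      ((abs_add_le x c).trans (by linarith))
    have h := (((key (δ / 2) (by rw [abs_le]; constructor <;> linarith)).add
      (key (-(δ / 2)) (by rw [abs_le]; constructor <;> linarith))).sub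
      (key (δ / 4) (by rw [abs_le]; constructor <;> linarith))).sub
      (key (-(δ / 4)) (by rw [abs_le]; constructor <;> linarith))
    convert! h using 1
    · ext n
      have hy : Real.cos (2 * Real.pi * n * y) = Real.cos (2 * Real.pi * n * x) := by
        rw [← Real.cos_sub_int_mul_two_pi _ (n * round y), hx]
        push_cast
        ring_nf
      rw [hy, trapezoidCoeff,
        show 2 * Real.pi * n * (x + δ / 2) = 2 * Real.pi * n * x + Real.pi * n * δ by ring,
        show 2 * Real.pi * n * (x + -(δ / 2)) = 2 * Real.pi * n * x - Real.pi * n * δ by ring,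
        show 2 * Real.pi * n * (x + δ / 4) = 2 * Real.pi * n * x + Real.pi * n * δ / 2 by ring,
        show 2 * Real.pi * n * (x + -(δ / 4)) = 2 * Real.pi * n * x - Real.pi * n * δ / 2 by ring]
      simp only [Real.cos_add, Real.cos_sub]
      ring
    · simp only [← sub_eq_add_neg]
      ring

/-- If `y` visits the interval `‖x‖ ≤ δ / 4` at least twice as often as expected, then one of the
first few Fourier modes is large. -/
lemma exists_large_cos_sum {ι : Type*} (s : Finset ι) (y : ι → ℝ) {δ : ℝ} (hδ0 : 0 < δ)
    (hδ1 : δ < 1) (hs : s.Nonempty)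
    (hcard : δ * #s ≤ #{i ∈ s | distToInt (y i) ≤ δ / 4}) :
    ∃ k : ℕ, 1 ≤ k ∧ (k : ℝ) ≤ 16 / δ ^ 2 ∧
      δ ^ 2 / 16 * #s ≤ |∑ i ∈ s, Real.cos (2 * Real.pi * k * y i)| := by
  by_contra! hcon
  choose V hV0 hV1 hV2 using fun i => hasSum_trapezoid hδ0 hδ1 (y i)
  set N : ℝ := (#s : ℝ) with hN
  have hNpos : 0 < N := by rw [hN]; exact_mod_cast hs.card_pos
  set C : ℕ → ℝ := fun n => ∑ i ∈ s, Real.cos (2 * Real.pi * n * y i) with hC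
  have hCN (n : ℕ) : |C n| ≤ N := by
    refine (abs_sum_le_sum_abs _ _).trans ?_
    rw [hN, card_eq_sum_ones, Nat.cast_sum, Nat.cast_one]
    exact sum_le_sum fun i _ => Real.abs_cos_le_one _
  have hsum : HasSum (fun n => trapezoidCoeff δ n * C n)
      (Real.pi ^ 2 * (3 * δ ^ 2 / 8 * N - ∑ i ∈ s, V i)) := by
    convert! hasSum_sum fun i (_ : i ∈ s) => hV2 i using 1
    · ext n
      rw [hC, mul_sum]
    · rw [← mul_sum, sum_sub_distrib, sum_const, nsmul_eq_mul, hN]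
      ring
  have hVs : δ / 2 * (δ * N) ≤ ∑ i ∈ s, V i := by
    calc δ / 2 * (δ * N) ≤ δ / 2 * #{i ∈ s | distToInt (y i) ≤ δ / 4} := by gcongr
      _ = ∑ i ∈ s with distToInt (y i) ≤ δ / 4, δ / 2 := by
        rw [sum_const, nsmul_eq_mul, mul_comm]
      _ ≤ ∑ i ∈ s with distToInt (y i) ≤ δ / 4, V i :=
        sum_le_sum fun i hi => hV1 i (mem_filter.1 hi).2
      _ ≤ _ := sum_le_sum_of_subset_of_nonneg (filter_subset _ _) fun i _ _ => hV0 i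
  set K := ⌊16 / δ ^ 2⌋₊
  have hK1 : 16 / δ ^ 2 < K + 1 := Nat.lt_floor_add_one _
  have hterm (n : ℕ) : |trapezoidCoeff δ n * C n| ≤ 1 / (n : ℝ) ^ 2 * (δ ^ 2 / 4 * N) +
      if K < n then 4 * N * ((n : ℝ) ^ 2)⁻¹ else 0 := by
    rw [abs_mul]
    have h1 := abs_trapezoidCoeff_le δ n
    split_ifs with h
    · have : |trapezoidCoeff δ n| * |C n| ≤ 4 * (1 / (n : ℝ) ^ 2) * N :=
        mul_le_mul h1 (hCN n) (abs_nonneg _) (by positivity)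
      have h3 : 0 ≤ 1 / (n : ℝ) ^ 2 * (δ ^ 2 / 4 * N) := by positivity
      rw [one_div] at *
      linarith
    · rcases Nat.eq_zero_or_pos n with rfl | hn
      · simp [trapezoidCoeff]
      have h2 := hcon n hn (by
        refine le_trans ?_ (Nat.floor_le (by positivity : 0 ≤ 16 / δ ^ 2))
        exact_mod_cast not_lt.1 h)
      have : |trapezoidCoeff δ n| * |C n| ≤ 4 * (1 / (n : ℝ) ^ 2) * (δ ^ 2 / 16 * N) :=
        mul_le_mul h1 h2.le (abs_nonneg _) (by positivity)
      linarith
  have hpartial (M : ℕ) : -∑ n ∈ range M, trapezoidCoeff δ n * C n ≤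
      Real.pi ^ 2 / 6 * (δ ^ 2 / 4 * N) + 4 * N * (2 / (K + 1)) := by
    calc -∑ n ∈ range M, trapezoidCoeff δ n * C n
        ≤ ∑ n ∈ range M, |trapezoidCoeff δ n * C n| :=
          (neg_le_abs _).trans (abs_sum_le_sum_abs _ _)
      _ ≤ _ := sum_le_sum fun n _ => hterm n
      _ = (∑ n ∈ range M, 1 / (n : ℝ) ^ 2) * (δ ^ 2 / 4 * N) +
          4 * N * ∑ n ∈ Ioo K M, ((n : ℝ) ^ 2)⁻¹ := by
        rw [sum_add_distrib, sum_mul, ← sum_filter, mul_sum]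
        congr 2
        ext n
        simp [and_comm]
      _ ≤ _ := by
        gcongr
        · exact sum_le_hasSum _ (fun n _ => by positivity) hasSum_zeta_two
        · exact sum_Ioo_inv_sq_le K M
  have hlim := le_of_tendsto hsum.tendsto_sum_nat.neg (Filter.Eventually.of_forall hpartial)
  have hKd : 2 / ((K : ℝ) + 1) ≤ δ ^ 2 / 8 := by
    rw [div_le_div_iff₀ (by positivity) (by norm_num)]
    rw [div_lt_iff₀ (by positivity)] at hK1
    linarith
  have hpi : 9 < Real.pi ^ 2 := by nlinarith [Real.pi_gt_three]
  have h1 : 4 * N * (2 / (K + 1)) ≤ 4 * N * (δ ^ 2 / 8) := by gcongr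
  have h2 : Real.pi ^ 2 * (δ / 2 * (δ * N)) ≤ Real.pi ^ 2 * ∑ i ∈ s, V i := by gcongr
  have h3 : 9 * (δ ^ 2 * N) < Real.pi ^ 2 * (δ ^ 2 * N) := by gcongr
  linarith [(by positivity : 0 ≤ δ ^ 2 * N)]

/-! ### Recurrent linear phases -/

lemma card_le_of_spacing {s : Finset ℤ} {q W : ℕ}
    (h : ∀ x ∈ s, ∀ y ∈ s, x ≤ y → ∃ j : ℕ, j ≤ W ∧ y = x + q * j) : #s ≤ W + 1 := by
  rcases s.eq_empty_or_nonempty with rfl | hs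
  · simp
  have hsub : s ⊆ (range (W + 1)).image fun j : ℕ => s.min' hs + (q : ℤ) * j := by
    intro y hy
    obtain ⟨j, hj, rfl⟩ := h _ (s.min'_mem hs) y hy (s.min'_le y hy)
    exact mem_image.2 ⟨j, by simpa [Nat.lt_succ_iff] using hj, rfl⟩
  simpa using (card_le_card hsub).trans card_image_le

lemma exists_pair_close {H : Finset ℤ} {A : ℤ} {L D : ℕ} (hD : 0 < D)
    (hH : ∀ h ∈ H, A ≤ h ∧ h < A + L) (hcard : L / D + 1 < #H) :
    ∃ x ∈ H, ∃ y ∈ H, x < y ∧ y - x ≤ D := by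
  have hDZ : (0 : ℤ) < D := by exact_mod_cast hD
  obtain ⟨x, hx, y, hy, hxy, he⟩ := exists_ne_map_eq_of_card_lt_of_maps_to
    (t := Icc (0 : ℤ) (L / D : ℕ)) (f := fun h : ℤ => (h - A) / D) (s := H)
    (by rw [Int.card_Icc]; generalize L / D = t at *; omega) (by
      intro h hh
      obtain ⟨h1, h2⟩ := hH h hh
      simp only [coe_Icc, Set.mem_Icc]
      refine ⟨Int.ediv_nonneg (by linarith) hDZ.le, ?_⟩
      push_cast
      exact Int.ediv_le_ediv hDZ (by linarith))
  have e1 := Int.emod_add_mul_ediv (x - A) D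
  have e2 := Int.emod_add_mul_ediv (y - A) D
  have b1 := Int.emod_nonneg (x - A) hDZ.ne'
  have b2 := Int.emod_nonneg (y - A) hDZ.ne'
  have c1 := Int.emod_lt_of_pos (x - A) hDZ
  have c2 := Int.emod_lt_of_pos (y - A) hDZ
  rw [he] at e1
  rcases lt_or_gt_of_ne hxy with h | h
  · exact ⟨x, hx, y, hy, h, by linarith⟩
  · exact ⟨y, hy, x, hx, h, by linarith⟩

/-- Counting the points at which a linear phase `θ` is close to zero, when `q * θ` is within `|κ|`
of an integer. -/
lemma card_le_of_linear_recurrent {θ ε κ : ℝ} {A r : ℤ} {L q : ℕ} {H : Finset ℤ} (hq : 0 < q)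
    (hκ : q * θ = r + κ) (hκ0 : κ ≠ 0) (hκ1 : |κ| ≤ 1 / 2) (hε : 0 ≤ ε)
    (hH : ∀ h ∈ H, A ≤ h ∧ h < A + L ∧ distToInt (h * θ) ≤ ε) :
    (#H : ℝ) ≤ (2 * ε / |κ| + 1) * (4 * |κ| * L + q) := by
  have hκp : 0 < |κ| := abs_pos.2 hκ0
  set m := ⌊1 / (2 * |κ|)⌋₊
  set W := ⌊2 * ε / |κ|⌋₊
  have hm_le : (m : ℝ) ≤ 1 / (2 * |κ|) := Nat.floor_le (by positivity)
  have hone : (1 : ℝ) ≤ 1 / (2 * |κ|) := by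
    rw [le_div_iff₀ (by positivity)]
    linarith
  have hm_pos : 0 < m := Nat.floor_pos.2 hone
  have hm1 : (1 : ℝ) ≤ m := by exact_mod_cast hm_pos
  have hm_ge : 1 / (4 * |κ|) ≤ m := by
    have h1 : 1 / (2 * |κ|) < m + 1 := Nat.lt_floor_add_one _
    have h2 : 1 / (4 * |κ|) = 1 / (2 * |κ|) / 2 := by field_simp; norm_num
    linarith
  have hqZ : (0 : ℤ) < q := by exact_mod_cast hq
  have hMZ : (0 : ℤ) < (q * m : ℕ) := by exact_mod_cast Nat.mul_pos hq hm_pos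
  have hspace : ∀ x ∈ H, ∀ y ∈ H, x ≤ y → x % q = y % q → y - x < (q * m : ℕ) →
      ∃ j : ℕ, j ≤ W ∧ y = x + q * j := by
    intro x hx y hy hxy hmod hlt
    obtain ⟨j, hj⟩ : (q : ℤ) ∣ y - x := Int.ModEq.dvd hmod
    have hj0 : 0 ≤ j := by
      by_contra! hneg
      nlinarith
    lift j to ℕ using hj0
    refine ⟨j, ?_, by linarith⟩
    have hjm : j ≤ m := by
      push_cast at hlt
      have : (j : ℤ) < m := lt_of_mul_lt_mul_left (hj ▸ hlt) hqZ.le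
      omega
    have hjκ : |j * κ| ≤ 1 / 2 := by
      rw [abs_mul, Nat.abs_cast]
      have : (j : ℝ) * |κ| ≤ 1 / (2 * |κ|) * |κ| := by
        gcongr
        exact (Nat.cast_le.2 hjm).trans hm_le
      refine this.trans_eq ?_
      field_simp
    have hd : distToInt (j * κ) ≤ 2 * ε := by
      have hjR : (y : ℝ) - x = q * j := by exact_mod_cast hj
      rw [show (j : ℝ) * κ = y * θ - x * θ - ((j * r : ℤ) : ℝ) by
        push_cast
        linear_combination (-θ) * hjR - (j : ℝ) * hκ, distToInt_sub_intCast]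
      linarith [distToInt_sub_le (y * θ) (x * θ), (hH x hx).2.2, (hH y hy).2.2]
    rw [distToInt_eq_abs hjκ, abs_mul, Nat.abs_cast] at hd
    exact Nat.le_floor ((le_div_iff₀ hκp).2 hd)
  have himage : H.image (fun h : ℤ => ((h - A) / (q * m : ℕ), h % q)) ⊆
      Icc (0 : ℤ) (L / (q * m) : ℕ) ×ˢ Ico (0 : ℤ) q := by
    intro p hp
    obtain ⟨h, hh, rfl⟩ := mem_image.1 hp
    obtain ⟨h1, h2, -⟩ := hH h hh
    simp only [mem_product, mem_Icc, mem_Ico]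
    refine ⟨⟨Int.ediv_nonneg (by linarith) hMZ.le, ?_⟩, Int.emod_nonneg _ hqZ.ne',
      Int.emod_lt_of_pos _ hqZ⟩
    rw [Int.natCast_div]
    exact Int.ediv_le_ediv hMZ (by linarith)
  have hcount : #H ≤ (W + 1) * ((L / (q * m) + 1) * q) := by
    refine (card_le_mul_card_image (f := fun h : ℤ => ((h - A) / (q * m : ℕ), h % q)) H (W + 1)
      ?_).trans (Nat.mul_le_mul_left _ ((card_le_card himage).trans_eq (by
        rw [card_product, Int.card_Icc, Int.card_Ico]
        congr 1)))
    rintro ⟨u, v⟩ -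
    refine card_le_of_spacing (q := q) fun x hx y hy hxy => ?_
    simp only [mem_filter, Prod.mk.injEq] at hx hy
    refine hspace x hx.1 y hy.1 hxy (hx.2.2.trans hy.2.2.symm) ?_
    have e1 := Int.emod_add_mul_ediv (x - A) (q * m : ℕ)
    have e2 := Int.emod_add_mul_ediv (y - A) (q * m : ℕ)
    have b1 := Int.emod_nonneg (x - A) hMZ.ne'
    have c2 := Int.emod_lt_of_pos (y - A) hMZ
    rw [hx.2.1] at e1
    rw [hy.2.1] at e2
    linarith
  have hLm : ((L / (q * m) : ℕ) : ℝ) * q ≤ 4 * |κ| * L := by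
    calc ((L / (q * m) : ℕ) : ℝ) * q ≤ (L / (q * m : ℕ) : ℝ) * q := by
          gcongr
          exact Nat.cast_div_le
      _ = L / m := by
          have : (q : ℝ) ≠ 0 := by positivity
          push_cast
          field_simp
      _ ≤ L / (1 / (4 * |κ|)) := by gcongr
      _ = 4 * |κ| * L := by field_simp
  calc (#H : ℝ) ≤ (W + 1) * (((L / (q * m) : ℕ) + 1) * q) := by exact_mod_cast hcount
    _ ≤ (2 * ε / |κ| + 1) * (4 * |κ| * L + q) := by
      gcongr
      · exact Nat.floor_le (by positivity)
      · linarith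

/-- A linear phase which is often very close to zero is non-diophantine. -/
lemma exists_small_multiple_of_linear_recurrent {θ ε η : ℝ} {A : ℤ} {L : ℕ} {H : Finset ℤ}
    (hη0 : 0 < η) (hη1 : η ≤ 1)
    (hH : ∀ h ∈ H, A ≤ h ∧ h < A + L ∧ distToInt (h * θ) ≤ ε)
    (hcard : η * L ≤ #H) (hε : 64 * ε ≤ η) (hL : 16 ≤ η ^ 2 * L) :
    ∃ q : ℕ, 1 ≤ q ∧ (q : ℝ) ≤ 3 / η ∧ distToInt (q * θ) ≤ 4 * ε * q / (η * L) := by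
  have hηL : 16 ≤ η * L := by nlinarith [mul_nonneg hη0.le (Nat.cast_nonneg (α := ℝ) L)]
  have hLp : (0 : ℝ) < L := by
    by_contra! h
    nlinarith
  set D := ⌈2 / η⌉₊
  have hD1 : 2 / η ≤ D := Nat.le_ceil _
  have hD2 : (D : ℝ) ≤ 3 / η := by
    have h1 : (D : ℝ) < 2 / η + 1 := Nat.ceil_lt_add_one (by positivity)
    have h2 : 1 ≤ 1 / η := by rwa [le_div_iff₀ hη0, one_mul]
    have h3 : 3 / η = 2 / η + 1 / η := by ring
    linarith
  have hDp : 0 < D := Nat.ceil_pos.2 (by positivity)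
  obtain ⟨x, hx, y, hy, hxy, hyx⟩ := exists_pair_close hDp
    (fun h hh => ⟨(hH h hh).1, (hH h hh).2.1⟩) (L := L) (by
      have h1 : ((L / D : ℕ) : ℝ) ≤ L / D := Nat.cast_div_le
      have h2 : (L : ℝ) / D ≤ L / (2 / η) := by gcongr
      have h3 : (L : ℝ) / (2 / η) = η * L / 2 := by field_simp
      have : ((L / D : ℕ) : ℝ) + 1 < #H := by linarith
      exact_mod_cast this)
  have hε0 : 0 ≤ ε := (distToInt_nonneg _).trans (hH x hx).2.2
  obtain ⟨q, hq⟩ : ∃ q : ℕ, y - x = q := ⟨(y - x).toNat, by omega⟩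
  have hq1 : 0 < q := by omega
  have hqR : (y : ℝ) - x = q := by exact_mod_cast hq
  have hqD : (q : ℝ) ≤ 3 / η := by
    refine le_trans ?_ hD2
    exact_mod_cast (hq ▸ hyx)
  refine ⟨q, hq1, hqD, ?_⟩
  set κ := q * θ - round (q * θ) with hκ
  change |κ| ≤ _
  have hκε : |κ| ≤ 2 * ε := by
    change distToInt (q * θ) ≤ _
    rw [← hqR, sub_mul]
    linarith [distToInt_sub_le (y * θ) (x * θ), (hH x hx).2.2, (hH y hy).2.2]
  by_cases hκ0 : κ = 0
  · rw [hκ0, abs_zero]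
    positivity
  have hκp : 0 < |κ| := abs_pos.2 hκ0
  have hc := hcard.trans (card_le_of_linear_recurrent hq1 (r := round (q * θ))
    (by rw [hκ]; ring) hκ0 (abs_sub_round _) hε0 hH)
  have hexp : (2 * ε / |κ| + 1) * (4 * |κ| * L + q) =
      8 * ε * L + 4 * |κ| * L + 2 * ε * q / |κ| + q := by
    field_simp
    ring
  have hq3 : (q : ℝ) ≤ 3 / 16 * (η * L) := by
    refine hqD.trans ?_
    rw [div_le_iff₀ hη0]
    linarith
  have h1 : |κ| * L ≤ 2 * ε * L := by gcongr
  have h2 : 64 * ε * L ≤ η * L := by gcongr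
  have h3 : η * L / 2 ≤ 2 * ε * q / |κ| := by linarith
  rw [le_div_iff₀ hκp] at h3
  rw [le_div_iff₀ (by positivity)]
  linarith

/-! ### Exponential sums -/

/-- The additive character `x ↦ exp (2πix)`. -/
noncomputable def phase (x : ℝ) : ℂ := Complex.exp ((2 * Real.pi * x : ℝ) * Complex.I)

lemma phase_add (x y : ℝ) : phase (x + y) = phase x * phase y := by
  rw [phase, phase, phase, ← Complex.exp_add]
  push_cast
  ring_nf

lemma norm_phase (x : ℝ) : ‖phase x‖ = 1 := Complex.norm_exp_ofReal_mul_I _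

lemma re_phase (x : ℝ) : (phase x).re = Real.cos (2 * Real.pi * x) := Complex.exp_ofReal_mul_I_re _

lemma conj_phase (x : ℝ) : (starRingEnd ℂ) (phase x) = phase (-x) := by
  rw [phase, phase, ← Complex.exp_conj, map_mul, Complex.conj_ofReal, Complex.conj_I]
  push_cast
  ring_nf

lemma phase_intCast (n : ℤ) : phase n = 1 := by
  rw [phase, Complex.exp_eq_one_iff]
  exact ⟨n, by push_cast; ring⟩

lemma four_mul_distToInt_le (x : ℝ) : 4 * distToInt x ≤ ‖phase x - 1‖ := by
  set r := x - round x with hr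
  have hx : phase x = phase r := by
    rw [show x = r + (round x : ℤ) by rw [hr]; ring, phase_add, phase_intCast, mul_one]
  have hr2 : |r| ≤ 1 / 2 := abs_sub_round x
  have hpi := Real.pi_pos
  have habs : |Real.pi * r| = Real.pi * |r| := by rw [abs_mul, abs_of_pos hpi]
  have hle : Real.pi * |r| ≤ Real.pi / 2 := by nlinarith
  have hsin : 2 * |r| ≤ |Real.sin (Real.pi * r)| := by
    rw [Real.abs_sin_eq_sin_abs_of_abs_le_pi (by rw [habs]; linarith), habs]
    refine le_trans (le_of_eq ?_) (Real.mul_le_sin (by positivity) hle)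
    field_simp
  have hnorm : ‖phase r - 1‖ = 2 * |Real.sin (Real.pi * r)| := by
    rw [phase, mul_comm, Complex.norm_exp_I_mul_ofReal_sub_one, Real.norm_eq_abs, abs_mul,
      abs_two]
    ring_nf
  rw [hx, hnorm]
  change 4 * |r| ≤ _
  linarith

lemma phase_sub_one_mul_sum_Ico (θ : ℝ) {u v : ℤ} (huv : u ≤ v) :
    (phase θ - 1) * ∑ l ∈ Ico u v, phase (θ * l) = phase (θ * v) - phase (θ * u) := by
  induction v, huv using Int.leInduction with
  | base => simp
  | succ n hn ih =>
    have : Ico u (n + 1) = insert n (Ico u n) := by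
      ext
      simp only [mem_Ico, mem_insert]
      omega
    rw [this, sum_insert (by simp), mul_add, ih]
    push_cast
    rw [mul_add, mul_one, phase_add]
    ring

lemma distToInt_mul_norm_sum_Icc_le (θ : ℝ) (u v : ℤ) :
    2 * distToInt θ * ‖∑ l ∈ Icc u v, phase (θ * l)‖ ≤ 1 := by
  rcases le_or_gt u v with h | h
  · have h1 : Icc u v = Ico u (v + 1) := by
      ext
      simp only [mem_Icc, mem_Ico]
      omega
    have h2 := congrArg norm (phase_sub_one_mul_sum_Ico θ (show u ≤ v + 1 by omega))
    rw [norm_mul, ← h1] at h2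
    have h3 : ‖phase (θ * (v + 1 : ℤ)) - phase (θ * u)‖ ≤ 2 :=
      (norm_sub_le _ _).trans (by rw [norm_phase, norm_phase]; norm_num)
    have h4 := mul_le_mul_of_nonneg_right (four_mul_distToInt_le θ)
      (norm_nonneg (∑ l ∈ Icc u v, phase (θ * l)))
    linarith
  · simp [Icc_eq_empty_of_lt h]

/-- Weyl differencing. -/
lemma sq_norm_sum_phase_le (f : ℤ → ℝ) (a b : ℤ) :
    ‖∑ l ∈ Icc a b, phase (f l)‖ ^ 2 ≤ ∑ h ∈ Icc (a - b) (b - a),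
      ‖∑ l ∈ Icc (max a (a - h)) (min b (b - h)), phase (f (l + h) - f l)‖ := by
  have hshift (l : ℤ) (hl : l ∈ Icc a b) : ∑ m ∈ Icc a b, phase (f m - f l) =
      ∑ h ∈ Icc (a - b) (b - a) with l + h ∈ Icc a b, phase (f (l + h) - f l) := by
    refine sum_nbij' (fun m => m - l) (fun h => l + h) ?_ ?_ ?_ ?_ ?_
    · intro m hm
      simp only [mem_filter, mem_Icc] at *
      omega
    · intro m hm
      exact (mem_filter.1 hm).2
    · intro m _
      ring
    · intro m _
      ring
    · intro m _
      rw [add_sub_cancel]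
  have hexpand : ((‖∑ l ∈ Icc a b, phase (f l)‖ ^ 2 : ℝ) : ℂ) =
      ∑ h ∈ Icc (a - b) (b - a),
        ∑ l ∈ Icc (max a (a - h)) (min b (b - h)), phase (f (l + h) - f l) := by
    rw [Complex.ofReal_pow, ← Complex.mul_conj', map_sum, mul_comm, sum_mul_sum]
    calc ∑ l ∈ Icc a b, ∑ m ∈ Icc a b, (starRingEnd ℂ) (phase (f l)) * phase (f m)
        = ∑ l ∈ Icc a b, ∑ h ∈ Icc (a - b) (b - a) with l + h ∈ Icc a b,
            phase (f (l + h) - f l) := by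
          refine sum_congr rfl fun l hl => ?_
          rw [← hshift l hl]
          refine sum_congr rfl fun m _ => ?_
          rw [conj_phase, ← phase_add, neg_add_eq_sub]
      _ = _ := by
          refine sum_comm' fun l h => ?_
          simp only [mem_filter, mem_Icc]
          omega
  have h := congrArg norm hexpand
  rw [Complex.norm_real, Real.norm_of_nonneg (by positivity)] at h
  rw [h]
  exact norm_sum_le _ _

/-- If a quadratic exponential sum over an interval is large, then many multiples of its leading
coefficient are close to integers. -/
lemma exists_many_small_multiples_of_large_sum {α β γ τ : ℝ} {a b : ℤ} (hab : a ≤ b) (hτ : 0 < τ)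
    (hsum : 4 * τ * (#(Icc a b) : ℝ) ^ 2 ≤ ‖∑ l ∈ Icc a b, phase (α * l ^ 2 + β * l + γ)‖ ^ 2) :
    ∃ H : Finset ℤ, (∀ h ∈ H, a - b ≤ h ∧ h < a - b + (2 * #(Icc a b) : ℕ) ∧
      distToInt (h * (2 * α)) ≤ 1 / (2 * τ * #(Icc a b))) ∧
      τ * (2 * #(Icc a b) : ℕ) ≤ #H := by
  set N := #(Icc a b) with hN
  have hNZ : (N : ℤ) = b - a + 1 := by
    rw [hN, Int.card_Icc]
    omega
  have hNp : (0 : ℝ) < N := by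
    have : (0 : ℤ) < N := by omega
    exact_mod_cast this
  set J := Icc (a - b) (b - a) with hJ
  have hJcard : (#J : ℝ) ≤ 2 * N := by
    have : #J ≤ 2 * N := by
      rw [hJ, Int.card_Icc]
      omega
    exact_mod_cast this
  set I : ℤ → Finset ℤ := fun h => Icc (max a (a - h)) (min b (b - h))
  set G : ℤ → ℝ := fun h => ‖∑ l ∈ I h, phase (h * (2 * α) * l)‖
  have hweyl : 4 * τ * (N : ℝ) ^ 2 ≤ ∑ h ∈ J, G h := by
    refine (hsum.trans (sq_norm_sum_phase_le (fun l => α * l ^ 2 + β * l + γ) a b)).trans_eq ?_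
    refine sum_congr rfl fun h _ => ?_
    have : ∑ l ∈ I h, phase (α * (l + h : ℤ) ^ 2 + β * (l + h : ℤ) + γ -
        (α * l ^ 2 + β * l + γ)) =
        phase (α * h ^ 2 + β * h) * ∑ l ∈ I h, phase (h * (2 * α) * l) := by
      rw [mul_sum]
      refine sum_congr rfl fun l _ => ?_
      rw [← phase_add]
      push_cast
      ring_nf
    change ‖∑ l ∈ I h, _‖ = _
    rw [this, norm_mul, norm_phase, one_mul]
  have hGN (h : ℤ) : G h ≤ N := by
    refine (norm_sum_le _ _).trans ?_
    simp only [norm_phase, sum_const, nsmul_one, Nat.cast_le, hN]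
    exact card_le_card (Icc_subset_Icc (le_max_left _ _) (min_le_left _ _))
  refine ⟨{h ∈ J | τ * N ≤ G h}, ?_, ?_⟩
  · intro h hh
    obtain ⟨h1, h2⟩ := mem_filter.1 hh
    rw [hJ, mem_Icc] at h1
    refine ⟨h1.1, by push_cast; omega, ?_⟩
    have h3 := distToInt_mul_norm_sum_Icc_le (h * (2 * α)) (max a (a - h)) (min b (b - h))
    have h4 := mul_le_mul_of_nonneg_left h2 (distToInt_nonneg (h * (2 * α)))
    rw [le_div_iff₀ (by positivity)]
    change 2 * distToInt (h * (2 * α)) * G h ≤ 1 at h3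
    linarith
  · have hsplit : ∑ h ∈ J, G h ≤ #{h ∈ J | τ * N ≤ G h} * (N : ℝ) + 2 * N * (τ * N) := by
      rw [← sum_filter_add_sum_filter_not J (fun h => τ * N ≤ G h)]
      gcongr
      · rw [← nsmul_eq_mul]
        exact sum_le_card_nsmul _ _ _ fun h _ => hGN h
      · refine (sum_le_card_nsmul _ _ (τ * N) fun h hh =>
          (not_le.1 (mem_filter.1 hh).2).le).trans ?_
        rw [nsmul_eq_mul]
        gcongr
        exact (Nat.cast_le.2 (card_filter_le _ _)).trans hJcard
    push_cast
    refine le_of_mul_le_mul_right ?_ hNp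
    linarith

/-- Recurrent quadratics are non-diophantine (Lemma A.13).  Let `I = [a,b] ⊆ ℤ` be a discrete
interval, `α, β, γ ∈ ℝ`, and `0 < δ₁, δ₂ < 1` with `δ₁ ≤ δ₂/4`.  Suppose
`#{l ∈ I : ‖αl² + βl + γ‖_{ℝ/ℤ} ≤ δ₁} ≥ δ₂ |I|` and `|I| ≥ 2⁵⁸ δ₂⁻¹²`.  Then there is an
integer `1 ≤ q ≤ 2⁴³ δ₂⁻⁹` with `‖qα‖_{ℝ/ℤ} ≤ 2¹⁴¹ δ₂⁻²⁸ |I|⁻²`. -/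
theorem recurrent_quadratic_nondiophantine (a b : ℤ) (α β γ : ℝ) (δ₁ δ₂ : ℝ)
    (hδ₁0 : 0 < δ₁) (hδ₁1 : δ₁ < 1) (hδ₂0 : 0 < δ₂) (hδ₂1 : δ₂ < 1) (hδ : δ₁ ≤ δ₂ / 4)
    (hcard : δ₂ * ((Finset.Icc a b).card : ℝ) ≤
      (((Finset.Icc a b).filter
        (fun l : ℤ => distToInt (α * l ^ 2 + β * l + γ) ≤ δ₁)).card : ℝ))
    (hI : 2 ^ 58 / δ₂ ^ 12 ≤ ((Finset.Icc a b).card : ℝ)) :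
    ∃ q : ℕ, 1 ≤ q ∧ (q : ℝ) ≤ 2 ^ 43 / δ₂ ^ 9 ∧
      distToInt (q * α) ≤ 2 ^ 141 / (δ₂ ^ 28 * ((Finset.Icc a b).card : ℝ) ^ 2) := by
  have hNp : (0 : ℝ) < #(Icc a b) := lt_of_lt_of_le (by positivity) hI
  have hne : (Icc a b).Nonempty := card_pos.1 (by exact_mod_cast hNp)
  have hab : a ≤ b := nonempty_Icc.1 hne
  obtain ⟨k, hk1, hk2, hk3⟩ := exists_large_cos_sum (Icc a b)
    (fun l : ℤ => α * l ^ 2 + β * l + γ) hδ₂0 hδ₂1 hne (hcard.trans (by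
      gcongr))
  set N := #(Icc a b) with hN
  set τ := δ₂ ^ 4 / 1024 with hτ
  have hτ0 : 0 < τ := by positivity
  have hlarge : 4 * τ * (N : ℝ) ^ 2 ≤
      ‖∑ l ∈ Icc a b, phase (k * α * l ^ 2 + k * β * l + k * γ)‖ ^ 2 := by
    have h1 : δ₂ ^ 2 / 16 * N ≤ ‖∑ l ∈ Icc a b, phase (k * α * l ^ 2 + k * β * l + k * γ)‖ := by
      refine (hk3.trans_eq ?_).trans (Complex.abs_re_le_norm _)
      rw [Complex.re_sum]
      congr 1
      refine sum_congr rfl fun l _ => ?_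
      rw [re_phase]
      ring_nf
    calc 4 * τ * (N : ℝ) ^ 2 = (δ₂ ^ 2 / 16 * N) ^ 2 := by rw [hτ]; ring
      _ ≤ _ := by gcongr
  obtain ⟨H, hH1, hH2⟩ := exists_many_small_multiples_of_large_sum hab hτ0 hlarge
  rw [← hN] at hH1 hH2
  rw [div_le_iff₀ (by positivity)] at hI
  have hpow {m n : ℕ} (h : m ≤ n) : δ₂ ^ n ≤ δ₂ ^ m := pow_le_pow_of_le_one hδ₂0.le hδ₂1.le h
  have hN8 : 2 ^ 58 ≤ N * δ₂ ^ 8 := hI.trans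
    (mul_le_mul_of_nonneg_left (hpow (by norm_num)) hNp.le)
  obtain ⟨q, hq1, hq2, hq3⟩ := exists_small_multiple_of_linear_recurrent hτ0
    (by have := hpow (Nat.zero_le 4); rw [hτ]; linarith) hH1 hH2 (by
      rw [mul_one_div, div_le_iff₀ (by positivity), hτ]
      linarith) (by
      push_cast
      rw [hτ]
      linarith)
  refine ⟨2 * k * q, by have := Nat.mul_pos hk1 hq1; lia, ?_, ?_⟩
  · push_cast
    calc (2 * k * q : ℝ) ≤ 2 * (16 / δ₂ ^ 2) * (3 / τ) := by gcongr
      _ = 98304 / δ₂ ^ 6 := by rw [hτ]; field_simp; norm_num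
      _ ≤ 2 ^ 43 / δ₂ ^ 9 := div_le_div₀ (by norm_num) (by norm_num) (by positivity) (hpow (by norm_num))
  · rw [show ((2 * k * q : ℕ) : ℝ) * α = q * (2 * (k * α)) by push_cast; ring]
    calc distToInt (q * (2 * (k * α))) ≤ 4 * (1 / (2 * τ * N)) * q / (τ * (2 * N : ℕ)) := hq3
      _ ≤ 4 * (1 / (2 * τ * N)) * (3 / τ) / (τ * (2 * N : ℕ)) := by gcongr
      _ = 3 * 2 ^ 30 / (δ₂ ^ 12 * N ^ 2) := by
        rw [hτ]
        push_cast
        field_simp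
        norm_num
      _ ≤ 2 ^ 141 / (δ₂ ^ 28 * N ^ 2) := div_le_div₀ (by norm_num) (by norm_num) (by positivity)
        (mul_le_mul_of_nonneg_right (hpow (by norm_num)) (by positivity))
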